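/- arXiv:2605.26318 — 9 statements merged into one kernel-verified Lean document; each statement's English description precedes it below -/
import Mathlib

section
/- Let A = U Σ Vᵀ where U ∈ ℝ^{m×m} and V ∈ ℝ^{n×n} are orthogonal and Σ ∈ ℝ^{m×n} is the block matrix [[D, 0], [0, 0]] with D ∈ ℝ^{r×r} diagonal with positive diagonal entries, and let H = V Γ Uᵀ with Γ = [[X, Y], [Z, W]]. If A H A = A, then (A H)ᵀ = A H if and only if Y = 0. -/
open Matrix

/-- Conjugation by matrices with orthonormal columns is injective. -/
theorem mul_mul_transpose_inj {k l : Type*} [Fintype k] [DecidableEq k] [Fintype l]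
    [DecidableEq l] {P : Matrix k k ℝ} {Q : Matrix l l ℝ} (hP : Pᵀ * P = 1) (hQ : Qᵀ * Q = 1)
    {M N : Matrix k l ℝ} : P * M * Qᵀ = P * N * Qᵀ ↔ M = N := by
  refine ⟨fun h => ?_, fun h => by rw [h]⟩
  have cancel (K : Matrix k l ℝ) : Pᵀ * (P * K * Qᵀ) * Q = K := by
    rw [Matrix.mul_assoc P, ← Matrix.mul_assoc Pᵀ, hP, Matrix.one_mul, Matrix.mul_assoc, hQ,
      Matrix.mul_one]
  rw [← cancel M, h, cancel]

/-- With `A = U Σ Vᵀ` (full SVD) and `H = V Γ Uᵀ`, `Γ = [[X,Y],[Z,W]]`, if (P1) `A H A = A`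
holds, then (P3) `(A H)ᵀ = A H` holds iff `Y = 0`. -/
theorem svd_P3_iff {r s t : ℕ}
    (U : Matrix (Fin r ⊕ Fin s) (Fin r ⊕ Fin s) ℝ)
    (V : Matrix (Fin r ⊕ Fin t) (Fin r ⊕ Fin t) ℝ)
    (hU : Uᵀ * U = 1) (hV : Vᵀ * V = 1)
    (d : Fin r → ℝ) (hd : ∀ i, 0 < d i)
    (X : Matrix (Fin r) (Fin r) ℝ) (Y : Matrix (Fin r) (Fin s) ℝ)
    (Z : Matrix (Fin t) (Fin r) ℝ) (W : Matrix (Fin t) (Fin s) ℝ)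
    (A : Matrix (Fin r ⊕ Fin s) (Fin r ⊕ Fin t) ℝ)
    (H : Matrix (Fin r ⊕ Fin t) (Fin r ⊕ Fin s) ℝ)
    (hA : A = U * (fromBlocks (diagonal d) 0 0 0 : Matrix (Fin r ⊕ Fin s) (Fin r ⊕ Fin t) ℝ) * Vᵀ)
    (hH : H = V * fromBlocks X Y Z W * Uᵀ)
    (hP1 : A * H * A = A) :
    (A * H)ᵀ = A * H ↔ Y = 0 := by
  have hdu : IsUnit (diagonal d) :=
    isUnit_diagonal.2 (Pi.isUnit_iff.2 fun i => (hd i).ne'.isUnit)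
  have hAH : A * H = U * fromBlocks (diagonal d * X) (diagonal d * Y) 0 0 * Uᵀ := by
    rw [hA, hH, Matrix.mul_assoc V, Matrix.mul_assoc _ Vᵀ, ← Matrix.mul_assoc Vᵀ, hV,
      Matrix.one_mul, ← Matrix.mul_assoc, Matrix.mul_assoc U, fromBlocks_multiply]
    simp
  have hX : diagonal d * X = 1 := by
    rw [hAH, hA, Matrix.mul_assoc U (fromBlocks (diagonal d) 0 0 0) Vᵀ, Matrix.mul_assoc _ Uᵀ,
      ← Matrix.mul_assoc Uᵀ, hU, Matrix.one_mul, ← Matrix.mul_assoc, ← Matrix.mul_assoc,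
      Matrix.mul_assoc U, mul_mul_transpose_inj hU hV, fromBlocks_multiply, fromBlocks_inj] at hP1
    exact hdu.mul_right_cancel (by simpa using hP1.1)
  rw [hAH, hX, transpose_mul, transpose_mul, transpose_transpose, ← Matrix.mul_assoc,
    mul_mul_transpose_inj hU hU, fromBlocks_transpose, fromBlocks_inj]
  refine ⟨fun h => ?_, fun h => by simp [h]⟩
  ext i j
  have hij := congrFun₂ h.2.1 i j
  rw [transpose_zero, Matrix.zero_apply, diagonal_mul] at hij
  exact (mul_eq_zero.1 hij.symm).resolve_left (hd i).ne'
end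

section
/- Let A = U Σ Vᵀ where U ∈ ℝ^{m×m} and V ∈ ℝ^{n×n} are orthogonal and Σ ∈ ℝ^{m×n} is the block matrix [[D, 0], [0, 0]] with D ∈ ℝ^{r×r} diagonal with positive diagonal entries, and let H = V Γ Uᵀ with Γ = [[X, Y], [Z, W]]. If A H A = A, then (H A)ᵀ = H A if and only if Z = 0. -/
open Matrix

/-- The inner factors of `(U * M * Qᵀ) * (Q * N * Vᵀ)` cancel if `Q` has orthonormal columns. -/
theorem mul_mul_transpose_mul {m n q k l p R : Type*} [Fintype k] [Fintype l] [Fintype p]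
    [Fintype q] [DecidableEq p] [CommRing R] {U : Matrix m k R} {Q : Matrix q p R}
    {V : Matrix n l R} (hQ : Qᵀ * Q = 1) (M : Matrix k p R) (N : Matrix p l R) :
    U * M * Qᵀ * (Q * N * Vᵀ) = U * (M * N) * Vᵀ := by
  calc U * M * Qᵀ * (Q * N * Vᵀ) = U * M * (Qᵀ * Q) * N * Vᵀ := by simp only [Matrix.mul_assoc]
    _ = U * (M * N) * Vᵀ := by rw [hQ, Matrix.mul_one, Matrix.mul_assoc U]

/-- Multiplying by matrices with orthonormal columns, as in `U * M * Vᵀ`, is injective. -/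
theorem mul_mul_transpose_inj_s4 {m n k l R : Type*} [Fintype m] [Fintype n] [Fintype k] [Fintype l]
    [DecidableEq k] [DecidableEq l] [CommRing R] {U : Matrix m k R} {V : Matrix n l R}
    (hU : Uᵀ * U = 1) (hV : Vᵀ * V = 1) {M N : Matrix k l R} :
    U * M * Vᵀ = U * N * Vᵀ ↔ M = N := by
  refine ⟨fun h => ?_, fun h => h ▸ rfl⟩
  have cancel (P : Matrix k l R) : Uᵀ * (U * P * Vᵀ) * V = P := by
    rw [Matrix.mul_assoc U, ← Matrix.mul_assoc Uᵀ, hU, Matrix.one_mul, Matrix.mul_assoc, hV,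
      Matrix.mul_one]
  rw [← cancel M, h, cancel]

/-- With `A = U Σ Vᵀ` (full SVD) and `H = V Γ Uᵀ`, `Γ = [[X,Y],[Z,W]]`, if (P1) `A H A = A`
holds, then (P4) `(H A)ᵀ = H A` holds iff `Z = 0`. -/
theorem svd_P4_iff {r s t : ℕ}
    (U : Matrix (Fin r ⊕ Fin s) (Fin r ⊕ Fin s) ℝ)
    (V : Matrix (Fin r ⊕ Fin t) (Fin r ⊕ Fin t) ℝ)
    (hU : Uᵀ * U = 1) (hV : Vᵀ * V = 1)
    (d : Fin r → ℝ) (hd : ∀ i, 0 < d i)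
    (X : Matrix (Fin r) (Fin r) ℝ) (Y : Matrix (Fin r) (Fin s) ℝ)
    (Z : Matrix (Fin t) (Fin r) ℝ) (W : Matrix (Fin t) (Fin s) ℝ)
    (A : Matrix (Fin r ⊕ Fin s) (Fin r ⊕ Fin t) ℝ)
    (H : Matrix (Fin r ⊕ Fin t) (Fin r ⊕ Fin s) ℝ)
    (hA : A = U * (fromBlocks (diagonal d) 0 0 0 : Matrix (Fin r ⊕ Fin s) (Fin r ⊕ Fin t) ℝ) * Vᵀ)
    (hH : H = V * fromBlocks X Y Z W * Uᵀ)
    (hP1 : A * H * A = A) :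
    (H * A)ᵀ = H * A ↔ Z = 0 := by
  have hD : IsUnit (diagonal d) :=
    isUnit_diagonal.2 (Pi.isUnit_iff.2 fun i => (hd i).ne'.isUnit)
  have hHA : H * A = V * (fromBlocks (X * diagonal d) 0 (Z * diagonal d) 0 :
      Matrix (Fin r ⊕ Fin t) (Fin r ⊕ Fin t) ℝ) * Vᵀ := by
    rw [hH, hA, mul_mul_transpose_mul hU, fromBlocks_multiply]
    simp only [Matrix.mul_zero, add_zero]
  have hXD : X * diagonal d = 1 := by
    rw [Matrix.mul_assoc, hHA, hA, mul_mul_transpose_mul hV, mul_mul_transpose_inj_s4 hU hV,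
      fromBlocks_multiply, fromBlocks_inj, Matrix.zero_mul, add_zero] at hP1
    exact hD.mul_left_cancel (hP1.1.trans (Matrix.mul_one _).symm)
  have hT : (H * A)ᵀ = V * (fromBlocks 1 (Z * diagonal d)ᵀ 0 0 :
      Matrix (Fin r ⊕ Fin t) (Fin r ⊕ Fin t) ℝ) * Vᵀ := by
    rw [hHA, hXD]
    simp [Matrix.mul_assoc, fromBlocks_transpose]
  rw [hT, hHA, hXD, mul_mul_transpose_inj_s4 hV hV, fromBlocks_inj]
  refine ⟨fun h => ?_, fun h => by simp [h]⟩
  calc Z = Z * (diagonal d * X) := by rw [mul_eq_one_comm.1 hXD, Matrix.mul_one]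
    _ = 0 := by rw [← Matrix.mul_assoc, ← h.2.2.1, Matrix.zero_mul]
end

section
/- Let A be a real symmetric positive semidefinite n×n matrix. Then an n×n real matrix H satisfies both A H A = A and Hᵀ = H if and only if H satisfies the single matrix equation A H A + H = A + Hᵀ. -/
open Matrix

open scoped MatrixOrder in
/-- If `A` is positive semidefinite, the map `K ↦ A * K * A` has no negative eigenvalue. -/
lemma eq_zero_of_mul_mul_eq_neg_smul {ι : Type*} [Fintype ι]
    {A K : Matrix ι ι ℝ} (hA : A.PosSemidef) {c : ℝ} (hc : 0 < c)
    (h : A * K * A = -(c • K)) : K = 0 := by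
  classical
  obtain ⟨B, rfl⟩ := CStarAlgebra.nonneg_iff_eq_star_mul_self.mp hA.nonneg
  rw [star_eq_conjTranspose] at h
  have h₁ : 0 ≤ ((B * K * Bᴴ)ᴴ * (B * K * Bᴴ)).trace :=
    (posSemidef_conjTranspose_mul_self _).trace_nonneg
  have h₂ : 0 ≤ (Kᴴ * K).trace := (posSemidef_conjTranspose_mul_self _).trace_nonneg
  have h₃ : ((B * K * Bᴴ)ᴴ * (B * K * Bᴴ)).trace = -(c * (Kᴴ * K).trace) := by
    calc ((B * K * Bᴴ)ᴴ * (B * K * Bᴴ)).trace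
        = (B * (Kᴴ * Bᴴ * B * K * Bᴴ)).trace := by
          simp only [conjTranspose_mul, conjTranspose_conjTranspose, Matrix.mul_assoc]
      _ = (Kᴴ * (Bᴴ * B * K * (Bᴴ * B))).trace := by
          rw [trace_mul_comm]
          simp only [Matrix.mul_assoc]
      _ = -(c * (Kᴴ * K).trace) := by
          rw [h, Matrix.mul_neg, Matrix.mul_smul, trace_neg, trace_smul, smul_eq_mul]
  exact trace_conjTranspose_mul_self_eq_zero_iff.mp (by nlinarith)

/-- For a real symmetric positive semidefinite matrix `A`, a matrix `H` is a symmetric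
generalized inverse of `A` (i.e. `A H A = A` and `Hᵀ = H`) iff `A H A + H = A + Hᵀ`. -/
theorem symm_geninv_iff {n : ℕ} (A : Matrix (Fin n) (Fin n) ℝ) (hA : A.PosSemidef)
    (H : Matrix (Fin n) (Fin n) ℝ) :
    (A * H * A = A ∧ Hᵀ = H) ↔ A * H * A + H = A + Hᵀ := by
  refine ⟨fun ⟨h, hH⟩ => by rw [h, hH], fun h => ?_⟩
  have hAt : Aᵀ = A := by simpa using hA.isHermitian.eq
  have ht : A * Hᵀ * A + Hᵀ = A + H := by
    simpa [hAt, Matrix.mul_assoc] using congrArg transpose h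
  have hK : Hᵀ - H = 0 := by
    refine eq_zero_of_mul_mul_eq_neg_smul hA two_pos ?_
    rw [Matrix.mul_sub, Matrix.sub_mul, eq_sub_of_add_eq h, eq_sub_of_add_eq ht, two_smul]
    abel
  have hH : Hᵀ = H := sub_eq_zero.mp hK
  exact ⟨add_right_cancel (h.trans (by rw [hH])), hH⟩
end

section
/- Let D ∈ ℝ^{r×r} be a diagonal matrix with positive diagonal entries, and let X ∈ ℝ^{r×r} satisfy D X D + X = D + Xᵀ. Then X = D⁻¹. -/
open Matrix

/-- If `D` is diagonal with positive diagonal entries and `D X D + X = D + Xᵀ`, then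
`X = D⁻¹`. -/
theorem diag_eq_inv {r : ℕ} (d : Fin r → ℝ) (hd : ∀ i, 0 < d i)
    (X : Matrix (Fin r) (Fin r) ℝ)
    (h : diagonal d * X * diagonal d + X = diagonal d + Xᵀ) :
    X = (diagonal d)⁻¹ := by
  have entry (i j : Fin r) : d i * X i j * d j + X i j = diagonal d i j + X j i := by
    simpa [mul_diagonal, diagonal_mul] using congrFun (congrFun h i) j
  refine (inv_eq_right_inv ?_).symm
  ext i j
  rw [diagonal_mul]
  rcases eq_or_ne i j with rfl | hij
  · have hii := entry i i
    rw [diagonal_apply_eq] at hii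
    rw [one_apply_eq]
    exact mul_right_cancel₀ (hd i).ne' (by linarith)
  · have h₁ := entry i j
    have h₂ := entry j i
    rw [diagonal_apply_ne _ hij] at h₁
    rw [diagonal_apply_ne _ hij.symm] at h₂
    have hp : 0 < d i * d j := mul_pos (hd i) (hd j)
    have hsum : X i j + X j i = 0 :=
      (mul_eq_zero.mp (by linear_combination h₁ + h₂ :
        (d i * d j) * (X i j + X j i) = 0)).resolve_left hp.ne'
    have hdiff : X i j - X j i = 0 :=
      (mul_eq_zero.mp (by linear_combination h₁ - h₂ :
        (d i * d j + 2) * (X i j - X j i) = 0)).resolve_left (by positivity)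
    rw [one_apply_ne hij, show X i j = 0 by linarith, mul_zero]
end

section
/- Let A be a real symmetric n×n matrix and let P be the Moore–Penrose pseudoinverse of A (so P satisfies A P A = A, P A P = P, (A P)ᵀ = A P, (P A)ᵀ = P A). For any V ∈ ℝ^{n×n}, define F := (1/2)(V + Vᵀ) − (1/2) A P (V + Vᵀ) P A + P. Then F belongs to the set C := {H ∈ ℝ^{n×n} : A H A = A and Hᵀ = H}, and F is the orthogonal projection of V onto C in the Frobenius norm: for every H ∈ C, ‖F − V‖_F ≤ ‖H − V‖_F. -/
open Matrix

/-- The Moore–Penrose pseudoinverse of a symmetric matrix commutes with it. -/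
theorem pinv_comm_of_symm {n : Type*} [Fintype n] {A P : Matrix n n ℝ} (hA : Aᵀ = A)
    (hP1 : A * P * A = A) (hP3 : (A * P)ᵀ = A * P) (hP4 : (P * A)ᵀ = P * A) :
    P * A = A * P := by
  have h4 : A * Pᵀ = P * A := by rwa [transpose_mul, hA] at hP4
  have hA' : A * Pᵀ * A = A := by
    simpa [transpose_mul, hA, Matrix.mul_assoc] using congrArg transpose hP1
  have hQ : P * A * (A * P) = A * P := by rw [← h4, ← Matrix.mul_assoc, hA']
  have hQ' : A * P * (P * A) = P * A := by rw [← h4, ← Matrix.mul_assoc, hP1]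
  rw [← hQ', ← hP3, ← hP4, ← transpose_mul, hQ]

/-- The Moore–Penrose pseudoinverse of a symmetric matrix is symmetric. -/
theorem pinv_symm_of_symm {n : Type*} [Fintype n] {A P : Matrix n n ℝ} (hA : Aᵀ = A)
    (hP1 : A * P * A = A) (hP2 : P * A * P = P)
    (hP3 : (A * P)ᵀ = A * P) (hP4 : (P * A)ᵀ = P * A) : Pᵀ = P := by
  have hc := pinv_comm_of_symm hA hP1 hP3 hP4
  have h3 : Pᵀ * A = A * P := by rwa [transpose_mul, hA] at hP3
  have h4 : A * Pᵀ = P * A := by rwa [transpose_mul, hA] at hP4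
  calc Pᵀ = Pᵀ * A * Pᵀ := by
        simpa [transpose_mul, hA, Matrix.mul_assoc] using (congrArg transpose hP2).symm
    _ = P * (A * Pᵀ) := by rw [h3, ← hc, Matrix.mul_assoc]
    _ = P := by rw [h4, hc, ← Matrix.mul_assoc, hP2]

theorem sum_sq_eq_trace {m n : Type*} [Fintype m] [Fintype n] (M : Matrix m n ℝ) :
    ∑ i, ∑ j, (M i j) ^ 2 = (Mᵀ * M).trace := by
  rw [Finset.sum_comm]
  simp [trace, mul_apply, sq]

/-- Pythagoras: adding a matrix orthogonal to `N` does not decrease the Frobenius norm. -/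
theorem sum_sq_le_sum_sq_add {m n : Type*} [Fintype m] [Fintype n] (D N : Matrix m n ℝ)
    (h : (Dᵀ * N).trace = 0) :
    ∑ i, ∑ j, (N i j) ^ 2 ≤ ∑ i, ∑ j, ((D + N) i j) ^ 2 := by
  have h' : (Nᵀ * D).trace = 0 := by
    rw [← trace_transpose, transpose_mul, transpose_transpose, h]
  have hD : 0 ≤ (Dᵀ * D).trace := by rw [← sum_sq_eq_trace]; positivity
  rw [sum_sq_eq_trace, sum_sq_eq_trace, transpose_add, Matrix.add_mul, Matrix.mul_add,
    Matrix.mul_add, trace_add, trace_add, trace_add, h, h']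
  linarith

/-- Closed-form projection onto the affine set of symmetric generalized inverses of a
symmetric matrix `A`, where `P` is the Moore–Penrose pseudoinverse of `A`:
`F := (1/2)(V + Vᵀ) − (1/2) A P (V + Vᵀ) P A + P` lies in
`C := {H : A H A = A, Hᵀ = H}` and minimizes the Frobenius distance to `V` over `C`. -/
theorem proj_symm_geninv {n : ℕ} (A P : Matrix (Fin n) (Fin n) ℝ) (hA : Aᵀ = A)
    (hP1 : A * P * A = A) (hP2 : P * A * P = P)
    (hP3 : (A * P)ᵀ = A * P) (hP4 : (P * A)ᵀ = P * A)
    (V F : Matrix (Fin n) (Fin n) ℝ)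
    (hF : F = (1/2 : ℝ) • (V + Vᵀ) - (1/2 : ℝ) • (A * P * (V + Vᵀ) * P * A) + P) :
    (A * F * A = A ∧ Fᵀ = F) ∧
      ∀ H : Matrix (Fin n) (Fin n) ℝ, A * H * A = A → Hᵀ = H →
        ∑ i, ∑ j, ((F - V) i j) ^ 2 ≤ ∑ i, ∑ j, ((H - V) i j) ^ 2 := by
  have hc := pinv_comm_of_symm hA hP1 hP3 hP4
  have hPt := pinv_symm_of_symm hA hP1 hP2 hP3 hP4
  have hAF : A * F * A = A := by
    have h : A * (A * P * (V + Vᵀ) * P * A) * A = A * (V + Vᵀ) * A := by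
      calc _ = A * (A * P) * (V + Vᵀ) * (P * A) * A := by simp only [Matrix.mul_assoc]
        _ = (A * (P * A)) * (V + Vᵀ) * (A * P * A) := by
          rw [hc]
          simp only [Matrix.mul_assoc]
        _ = _ := by rw [← Matrix.mul_assoc A P A, hP1]
    rw [hF, Matrix.mul_add, Matrix.add_mul, hP1, Matrix.mul_sub, Matrix.sub_mul, Matrix.mul_smul,
      Matrix.mul_smul, Matrix.smul_mul, Matrix.smul_mul, h, sub_self, zero_add]
  have hFt : Fᵀ = F := by
    have h : (A * P * (V + Vᵀ) * P * A)ᵀ = A * P * (V + Vᵀ) * P * A := by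
      simp only [transpose_mul, transpose_add, transpose_transpose, hA, hPt, Matrix.mul_assoc,
        add_comm Vᵀ V]
    rw [hF, transpose_add, transpose_sub, transpose_smul, transpose_smul, h, hPt, transpose_add,
      transpose_transpose, add_comm Vᵀ V]
  refine ⟨⟨hAF, hFt⟩, fun H hAH hHt => ?_⟩
  have hADA : A * (H - F) * A = 0 := by rw [Matrix.mul_sub, Matrix.sub_mul, hAH, hAF, sub_self]
  have hDt : (H - F)ᵀ = H - F := by rw [transpose_sub, hHt, hFt]
  have hHV : H - V = (H - F) + (F - V) := by abel
  rw [hHV]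
  generalize H - F = D at hADA hDt
  apply sum_sq_le_sum_sq_add
  have hort (X : Matrix (Fin n) (Fin n) ℝ) : (D * (A * X * A)).trace = 0 := by
    rw [← Matrix.mul_assoc, trace_mul_comm, ← Matrix.mul_assoc, ← Matrix.mul_assoc, hADA,
      Matrix.zero_mul, trace_zero]
  have hP : P = A * (P * P * P) * A := by
    calc P = P * A * (P * A * P) := by rw [hP2, hP2]
      _ = (P * A) * P * (A * P) := by simp only [Matrix.mul_assoc]
      _ = (A * P) * P * (P * A) := by rw [hc]
      _ = _ := by simp only [Matrix.mul_assoc]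
  have hV : (D * Vᵀ).trace = (D * V).trace := by
    rw [← trace_transpose, transpose_mul, transpose_transpose, hDt, trace_mul_comm]
  have hFV : F - V = (1/2 : ℝ) • (Vᵀ - V)
      - (1/2 : ℝ) • (A * (P * (V + Vᵀ) * P) * A) + A * (P * P * P) * A := by
    rw [← hP, hF]
    simp only [Matrix.mul_assoc]
    module
  rw [hDt, hFV, Matrix.mul_add, Matrix.mul_sub, Matrix.mul_smul, Matrix.mul_smul, trace_add,
    trace_sub, trace_smul, trace_smul, hort, hort, Matrix.mul_sub, trace_sub, hV]
  simp
end

section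
/- Let λ ≥ 0, A ∈ ℝ^{m×n}, b ∈ ℝ^{m}, L ∈ ℝ^{p×n}, and set Â := AᵀA + λ LᵀL. If Ĥ ∈ ℝ^{n×n} is a generalized inverse of Â (i.e. Â Ĥ Â = Â), then θ̂ := Ĥ Aᵀ b is a global minimizer of the generalized Tikhonov objective: for every θ ∈ ℝ^{n}, ‖A θ̂ − b‖₂² + λ ‖L θ̂‖₂² ≤ ‖A θ − b‖₂² + λ ‖L θ‖₂². -/
open Matrix

theorem dotProduct_tikhonov_mulVec {m n p : ℕ} (lam : ℝ) (A : Matrix (Fin m) (Fin n) ℝ)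
    (L : Matrix (Fin p) (Fin n) ℝ) (x y : Fin n → ℝ) :
    y ⬝ᵥ ((Aᵀ * A + lam • (Lᵀ * L)) *ᵥ x) =
      (A *ᵥ y) ⬝ᵥ (A *ᵥ x) + lam * ((L *ᵥ y) ⬝ᵥ (L *ᵥ x)) := by
  simp only [add_mulVec, smul_mulVec, ← mulVec_mulVec, dotProduct_add, dotProduct_smul,
    dotProduct_mulVec _ Aᵀ, dotProduct_mulVec _ Lᵀ, vecMul_transpose, smul_eq_mul]

/-- The kernel of `AᵀA + λ LᵀL` is contained in the kernel of `A`. -/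
theorem mulVec_eq_zero_of_tikhonov_mulVec_eq_zero {m n p : ℕ} {lam : ℝ} (hlam : 0 ≤ lam)
    (A : Matrix (Fin m) (Fin n) ℝ) (L : Matrix (Fin p) (Fin n) ℝ) {x : Fin n → ℝ}
    (hx : (Aᵀ * A + lam • (Lᵀ * L)) *ᵥ x = 0) : A *ᵥ x = 0 := by
  have h := dotProduct_tikhonov_mulVec lam A L x x
  rw [hx, dotProduct_zero] at h
  have hA : 0 ≤ (A *ᵥ x) ⬝ᵥ (A *ᵥ x) := Finset.sum_nonneg fun i _ => mul_self_nonneg _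
  have hL : 0 ≤ (L *ᵥ x) ⬝ᵥ (L *ᵥ x) := Finset.sum_nonneg fun i _ => mul_self_nonneg _
  exact dotProduct_self_eq_zero.mp (by linarith [mul_nonneg hlam hL])

/-- A generalized inverse of `AᵀA + λ LᵀL` solves the regularized normal equations. -/
theorem tikhonov_mul_generalized_inverse_mul_transpose {m n p : ℕ} {lam : ℝ} (hlam : 0 ≤ lam)
    (A : Matrix (Fin m) (Fin n) ℝ) (L : Matrix (Fin p) (Fin n) ℝ)
    {H : Matrix (Fin n) (Fin n) ℝ}
    (hH : (Aᵀ * A + lam • (Lᵀ * L)) * H * (Aᵀ * A + lam • (Lᵀ * L))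
      = Aᵀ * A + lam • (Lᵀ * L)) :
    (Aᵀ * A + lam • (Lᵀ * L)) * H * Aᵀ = Aᵀ := by
  have hker := fun x => mulVec_eq_zero_of_tikhonov_mulVec_eq_zero hlam A L (x := x)
  have hsymm : (Aᵀ * A + lam • (Lᵀ * L))ᵀ = Aᵀ * A + lam • (Lᵀ * L) := by
    simp [transpose_mul]
  generalize Aᵀ * A + lam • (Lᵀ * L) = M at hH hker hsymm ⊢
  have hM : M * (1 - M * H)ᵀ = 0 := by
    rw [← transpose_inj, transpose_mul, transpose_transpose, hsymm, sub_mul, one_mul, hH,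
      sub_self, transpose_zero]
  have hA : A * (1 - M * H)ᵀ = 0 := by
    refine ext_of_mulVec_single fun i => ?_
    rw [← mulVec_mulVec, zero_mulVec]
    exact hker _ (by rw [mulVec_mulVec, hM, zero_mulVec])
  have hE : (1 - M * H) * Aᵀ = 0 := by
    rw [← transpose_inj, transpose_mul, transpose_transpose, hA, transpose_zero]
  rw [Matrix.sub_mul, Matrix.one_mul, sub_eq_zero] at hE
  exact hE.symm

/-- If `Ĥ` is a generalized inverse of `Â := AᵀA + λ LᵀL`, then `θ̂ := Ĥ Aᵀ b` is a global
minimizer of the generalized Tikhonov objective `‖Aθ − b‖₂² + λ‖Lθ‖₂²`. -/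
theorem tikhonov_closed_form {m n p : ℕ} (lam : ℝ) (hlam : 0 ≤ lam)
    (A : Matrix (Fin m) (Fin n) ℝ) (b : Fin m → ℝ) (L : Matrix (Fin p) (Fin n) ℝ)
    (Hhat : Matrix (Fin n) (Fin n) ℝ)
    (hGI : (Aᵀ * A + lam • (Lᵀ * L)) * Hhat * (Aᵀ * A + lam • (Lᵀ * L))
            = Aᵀ * A + lam • (Lᵀ * L)) :
    ∀ θ : Fin n → ℝ,
      (∑ i, (A.mulVec (Hhat.mulVec (Aᵀ.mulVec b)) - b) i ^ 2)
        + lam * ∑ j, (L.mulVec (Hhat.mulVec (Aᵀ.mulVec b))) j ^ 2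
      ≤ (∑ i, (A.mulVec θ - b) i ^ 2) + lam * ∑ j, (L.mulVec θ) j ^ 2 := by
  intro θ
  have hnormal : (Aᵀ * A + lam • (Lᵀ * L)) *ᵥ (Hhat *ᵥ (Aᵀ *ᵥ b)) = Aᵀ *ᵥ b := by
    rw [mulVec_mulVec, mulVec_mulVec,
      tikhonov_mul_generalized_inverse_mul_transpose hlam A L hGI]
  generalize Hhat *ᵥ (Aᵀ *ᵥ b) = x at hnormal ⊢
  obtain ⟨d, rfl⟩ : ∃ d, θ = x + d := ⟨θ - x, by simp⟩
  have hcross := dotProduct_tikhonov_mulVec lam A L x d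
  rw [hnormal, dotProduct_mulVec, vecMul_transpose] at hcross
  have hsum : ∀ {k : ℕ} (u : Fin k → ℝ), ∑ i, u i ^ 2 = u ⬝ᵥ u := fun u => by
    simp only [dotProduct, sq]
  have hA : 0 ≤ (A *ᵥ d) ⬝ᵥ (A *ᵥ d) := Finset.sum_nonneg fun i _ => mul_self_nonneg _
  have hL : 0 ≤ lam * ((L *ᵥ d) ⬝ᵥ (L *ᵥ d)) :=
    mul_nonneg hlam (Finset.sum_nonneg fun i _ => mul_self_nonneg _)
  simp only [hsum, mulVec_add, dotProduct_add, add_dotProduct, dotProduct_sub, sub_dotProduct]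
  rw [dotProduct_comm (A *ᵥ x) (A *ᵥ d), dotProduct_comm (L *ᵥ x) (L *ᵥ d),
    dotProduct_comm b (A *ᵥ d)]
  linarith
end

section
/- For every A ∈ ℝ^{m×n}, there exist a generalized inverse H ∈ ℝ^{n×m} of A (i.e. A H A = A) and a generalized inverse Ĥ ∈ ℝ^{n×n} of AᵀA (i.e. (AᵀA) Ĥ (AᵀA) = AᵀA) such that H = Ĥ Aᵀ. -/
/-- Every linear map between vector spaces has a generalized inverse. -/
theorem LinearMap.exists_generalizedInverse {K V W : Type*} [DivisionRing K]
    [AddCommGroup V] [Module K V] [AddCommGroup W] [Module K W] (f : V →ₗ[K] W) :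
    ∃ g : W →ₗ[K] V, f ∘ₗ g ∘ₗ f = f := by
  obtain ⟨s, hs⟩ := f.rangeRestrict.exists_rightInverse_of_surjective f.range_rangeRestrict
  obtain ⟨g, hg⟩ := s.exists_extend
  refine ⟨g, LinearMap.ext fun x => ?_⟩
  have h₁ : g (f x) = s (f.rangeRestrict x) := LinearMap.congr_fun hg (f.rangeRestrict x)
  have h₂ : f.rangeRestrict (s (f.rangeRestrict x)) = f.rangeRestrict x :=
    LinearMap.congr_fun hs (f.rangeRestrict x)
  simpa [h₁] using congrArg Subtype.val h₂

/-- Every matrix over a field has a generalized inverse. -/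
theorem Matrix.exists_generalizedInverse {K m n : Type*} [Field K] [Fintype m] [Fintype n]
    (M : Matrix m n K) : ∃ G : Matrix n m K, M * G * M = M := by
  classical
  obtain ⟨g, hg⟩ := (Matrix.toLin' M).exists_generalizedInverse
  refine ⟨LinearMap.toMatrix' g, Matrix.toLin'.injective ?_⟩
  simpa [Matrix.toLin'_mul, LinearMap.comp_assoc] using hg

open Matrix

/-- For every `A`, there exist a generalized inverse `H` of `A` and a generalized inverse
`Ĥ` of `AᵀA` with `H = Ĥ Aᵀ`. -/
theorem exists_H_Hhat {m n : ℕ} (A : Matrix (Fin m) (Fin n) ℝ) :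
    ∃ (H : Matrix (Fin n) (Fin m) ℝ) (Hhat : Matrix (Fin n) (Fin n) ℝ),
      A * H * A = A ∧ (Aᵀ * A) * Hhat * (Aᵀ * A) = Aᵀ * A ∧ H = Hhat * Aᵀ := by
  obtain ⟨G, hG⟩ := (Aᵀ * A).exists_generalizedInverse
  refine ⟨G * Aᵀ, G, ?_, hG, rfl⟩
  have h : Aᴴ * A * (G * (Aᵀ * A) - 1) = 0 := by
    rw [conjTranspose_eq_transpose_of_trivial, Matrix.mul_sub, ← Matrix.mul_assoc, hG,
      Matrix.mul_one, sub_self]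
  rw [conjTranspose_mul_self_mul_eq_zero, Matrix.mul_sub, Matrix.mul_one, sub_eq_zero] at h
  simpa only [Matrix.mul_assoc] using h
end

section
/- Let A ∈ ℝ^{m×n} admit the block singular value decomposition A = U₁ D V₁ᵀ, where U₁ ∈ ℝ^{m×r}, U₂ ∈ ℝ^{m×(m−r)}, V₁ ∈ ℝ^{n×r}, V₂ ∈ ℝ^{n×(n−r)} satisfy U₁ᵀU₁ = I_r, U₂ᵀU₂ = I_{m−r}, U₁ᵀU₂ = 0, U₁U₁ᵀ + U₂U₂ᵀ = I_m, V₁ᵀV₁ = I_r, V₂ᵀV₂ = I_{n−r}, V₁ᵀV₂ = 0, V₁V₁ᵀ + V₂V₂ᵀ = I_n, and D ∈ ℝ^{r×r} is diagonal with positive diagonal entries. Then H ∈ ℝ^{n×m} satisfies A H A = A, H A H = H, and (A H)ᵀ = A H if and only if there exists Z ∈ ℝ^{(n−r)×r} such that H = V₁ D⁻¹ U₁ᵀ + V₂ Z U₁ᵀ. -/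
open Matrix

/-- Characterization of ah-symmetric reflexive generalized inverses via the block SVD
`A = U₁ D V₁ᵀ`: `H` satisfies (P1), (P2), (P3) iff `H = V₁ D⁻¹ U₁ᵀ + V₂ Z U₁ᵀ` for some
`Z`. -/
theorem ah_reflexive_char {m n r : ℕ}
    (U₁ : Matrix (Fin m) (Fin r) ℝ) (U₂ : Matrix (Fin m) (Fin (m - r)) ℝ)
    (V₁ : Matrix (Fin n) (Fin r) ℝ) (V₂ : Matrix (Fin n) (Fin (n - r)) ℝ)
    (hU₁ : U₁ᵀ * U₁ = 1) (hU₂ : U₂ᵀ * U₂ = 1) (hU₁₂ : U₁ᵀ * U₂ = 0)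
    (hU : U₁ * U₁ᵀ + U₂ * U₂ᵀ = 1)
    (hV₁ : V₁ᵀ * V₁ = 1) (hV₂ : V₂ᵀ * V₂ = 1) (hV₁₂ : V₁ᵀ * V₂ = 0)
    (hV : V₁ * V₁ᵀ + V₂ * V₂ᵀ = 1)
    (d : Fin r → ℝ) (hd : ∀ i, 0 < d i)
    (A : Matrix (Fin m) (Fin n) ℝ) (hA : A = U₁ * diagonal d * V₁ᵀ)
    (H : Matrix (Fin n) (Fin m) ℝ) :
    (A * H * A = A ∧ H * A * H = H ∧ (A * H)ᵀ = A * H) ↔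
      ∃ Z : Matrix (Fin (n - r)) (Fin r) ℝ,
        H = V₁ * (diagonal d)⁻¹ * U₁ᵀ + V₂ * Z * U₁ᵀ := by
  have hdet : IsUnit (diagonal d).det := by
    rw [det_diagonal, isUnit_iff_ne_zero]
    exact Finset.prod_ne_zero_iff.mpr fun i _ => (hd i).ne'
  have hDE : diagonal d * (diagonal d)⁻¹ = 1 := mul_nonsing_inv _ hdet
  have hED : (diagonal d)⁻¹ * diagonal d = 1 := nonsing_inv_mul _ hdet
  generalize diagonal d = D at *
  generalize D⁻¹ = E at *
  have hUA : U₁ᵀ * A = D * V₁ᵀ := by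
    rw [hA, Matrix.mul_assoc, ← Matrix.mul_assoc, hU₁, Matrix.one_mul]
  have hAV : A * V₁ = U₁ * D := by
    rw [hA, Matrix.mul_assoc, hV₁, Matrix.mul_one]
  constructor
  · rintro ⟨h1, h2, h3⟩
    have hAH : A * H = U₁ * (D * V₁ᵀ * H) := by
      rw [hA]
      simp only [Matrix.mul_assoc]
    have hKU : D * V₁ᵀ * H * U₁ = 1 := by
      have h : D * V₁ᵀ * H * U₁ * D = D := by
        calc D * V₁ᵀ * H * U₁ * D = U₁ᵀ * (A * H * A) * V₁ := by
              rw [← hUA, Matrix.mul_assoc _ U₁ D, ← hAV]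
              simp only [Matrix.mul_assoc]
          _ = D := by
              rw [h1, hUA, Matrix.mul_assoc, hV₁, Matrix.mul_one]
      calc D * V₁ᵀ * H * U₁ = D * V₁ᵀ * H * U₁ * D * E := by
            rw [Matrix.mul_assoc _ D E, hDE, Matrix.mul_one]
        _ = 1 := by rw [h, hDE]
    have hK : D * V₁ᵀ * H = U₁ᵀ := by
      calc D * V₁ᵀ * H = U₁ᵀ * (A * H) := by
            rw [hAH, ← Matrix.mul_assoc, hU₁, Matrix.one_mul]
        _ = (D * V₁ᵀ * H * U₁)ᵀ * U₁ᵀ := by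
            rw [← h3, hAH, transpose_mul, transpose_mul _ U₁, Matrix.mul_assoc U₁ᵀ]
        _ = U₁ᵀ := by rw [hKU, transpose_one, Matrix.one_mul]
    have hVH : V₁ᵀ * H = E * U₁ᵀ := by
      rw [← hK, Matrix.mul_assoc D, ← Matrix.mul_assoc E, hED, Matrix.one_mul]
    have hH : H = H * U₁ * U₁ᵀ := by
      rw [hK] at hAH
      rw [Matrix.mul_assoc, ← hAH, ← Matrix.mul_assoc, h2]
    refine ⟨V₂ᵀ * H * U₁, ?_⟩
    calc H = (V₁ * V₁ᵀ + V₂ * V₂ᵀ) * H := by rw [hV, Matrix.one_mul]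
      _ = V₁ * (V₁ᵀ * H) + V₂ * (V₂ᵀ * H) := by
          rw [Matrix.add_mul, Matrix.mul_assoc, Matrix.mul_assoc]
      _ = V₁ * (E * U₁ᵀ) + V₂ * (V₂ᵀ * (H * U₁ * U₁ᵀ)) := by rw [hVH, ← hH]
      _ = V₁ * E * U₁ᵀ + V₂ * (V₂ᵀ * H * U₁) * U₁ᵀ := by
          simp only [Matrix.mul_assoc]
  · rintro ⟨Z, hH⟩
    have hVH : V₁ᵀ * H = E * U₁ᵀ := by
      rw [hH, Matrix.mul_add]
      simp only [← Matrix.mul_assoc]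
      rw [hV₁, hV₁₂, Matrix.one_mul, Matrix.zero_mul, Matrix.zero_mul, add_zero]
    have hAH : A * H = U₁ * U₁ᵀ := by
      rw [hA, Matrix.mul_assoc, hVH, Matrix.mul_assoc, ← Matrix.mul_assoc D, hDE,
        Matrix.one_mul]
    have hHU : H * U₁ * U₁ᵀ = H := by
      rw [hH]
      simp only [Matrix.add_mul, Matrix.mul_assoc]
      simp only [← Matrix.mul_assoc U₁ᵀ U₁, hU₁, Matrix.one_mul]
    refine ⟨?_, ?_, ?_⟩
    · rw [hAH, Matrix.mul_assoc, hUA, hA, Matrix.mul_assoc]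
    · rw [Matrix.mul_assoc, hAH, ← Matrix.mul_assoc, hHU]
    · rw [hAH, transpose_mul, transpose_transpose]
end

section
/- Let A ∈ ℝ^{m×n} and let H ∈ ℝ^{n×m} be a generalized inverse of A, i.e. A H A = A. Then rank(H) = rank(A) if and only if H is reflexive, i.e. H A H = H. -/
open Matrix

/-- If `A * H * A = A` then `H * A` has the same rank as `A`. -/
theorem Matrix.rank_mul_eq_of_mul_mul_eq {K m n : Type*} [Field K] [Fintype m] [Fintype n]
    {A : Matrix m n K} {H : Matrix n m K} (h : A * H * A = A) : (H * A).rank = A.rank := by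
  refine le_antisymm (rank_mul_le_right H A) ?_
  calc A.rank = (A * (H * A)).rank := by rw [← Matrix.mul_assoc, h]
    _ ≤ (H * A).rank := rank_mul_le_right _ _

/-- If `A * H * A = A` and `H` has rank at most that of `A`, then `H * A * H = H`. -/
theorem Matrix.mul_mul_eq_of_rank_le {K m n : Type*} [Field K] [Fintype m] [Fintype n]
    {A : Matrix m n K} {H : Matrix n m K} (h : A * H * A = A) (hr : H.rank ≤ A.rank) :
    H * A * H = H := by
  have hle : LinearMap.range (H * A).mulVecLin ≤ LinearMap.range H.mulVecLin := by
    rw [mulVecLin_mul]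
    exact LinearMap.range_comp_le_range _ _
  have heq : LinearMap.range (H * A).mulVecLin = LinearMap.range H.mulVecLin :=
    Submodule.eq_of_le_of_finrank_le hle (hr.trans (rank_mul_eq_of_mul_mul_eq h).ge)
  apply mulVec_injective
  funext x
  have hx : H *ᵥ x ∈ LinearMap.range (H * A).mulVecLin := heq ▸ ⟨x, rfl⟩
  obtain ⟨y, hy⟩ := hx
  rw [mulVecLin_apply] at hy
  rw [← mulVec_mulVec, ← hy, mulVec_mulVec, Matrix.mul_assoc, ← Matrix.mul_assoc A, h]

/-- A generalized inverse `H` of `A` satisfies `rank H = rank A` iff it is reflexive,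
i.e. `H A H = H`. -/
theorem geninv_rank_eq_iff_reflexive {m n : ℕ} (A : Matrix (Fin m) (Fin n) ℝ)
    (H : Matrix (Fin n) (Fin m) ℝ) (hP1 : A * H * A = A) :
    H.rank = A.rank ↔ H * A * H = H := by
  refine ⟨fun hr => mul_mul_eq_of_rank_le hP1 hr.le, fun hP2 => le_antisymm ?_ ?_⟩
  · calc H.rank = (H * A * H).rank := by rw [hP2]
      _ ≤ (H * A).rank := rank_mul_le_left _ _
      _ = A.rank := rank_mul_eq_of_mul_mul_eq hP1
  · exact (rank_mul_eq_of_mul_mul_eq hP1).symm.trans_le (rank_mul_le_left _ _)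
end
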